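/- Let Ω ⊆ ℝ³ be a domain convex in the directions of the lines L₁ and L₂, and assume that at least one number in each of the pairs (a₁, b₁) and (a₂, b₂) lies in ℂ∖ℝ. If Φ : Ω_ζ → ℍ(ℂ) is right-G-monogenic in Ω_ζ, then its right Gateaux derivative Φ′ is again right-G-monogenic in Ω_ζ, and likewise the Gateaux derivatives of all orders of Φ are right-G-monogenic in Ω_ζ; analogously, the left Gateaux derivatives of all orders of a left-G-monogenic mapping Φ̂ : Ω_ζ → ℍ(ℂ) are left-G-monogenic in Ω_ζ. -/

import Mathlib

open Filter Set Topology Quaternion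

noncomputable section

abbrev HC : Type := ℍ[ℂ, -1, -1]

/-- The idempotent `e₁ = (1 + iI)/2`. -/
def e1 : HC := ⟨1/2, Complex.I/2, 0, 0⟩
/-- The idempotent `e₂ = (1 - iI)/2`. -/
def e2 : HC := ⟨1/2, -(Complex.I/2), 0, 0⟩
/-- `e₃ = (iJ - K)/2`. -/
def e3 : HC := ⟨0, 0, Complex.I/2, -(1/2)⟩
/-- `e₄ = (iJ + K)/2`. -/
def e4 : HC := ⟨0, 0, Complex.I/2, 1/2⟩

/-- Topology on `ℍ(ℂ)` induced from the four complex coordinates. -/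
instance : TopologicalSpace HC :=
  TopologicalSpace.induced (fun q : HC => (q.re, q.imI, q.imJ, q.imK)) inferInstance

/-- Coordinate of `a ∈ ℍ(ℂ)` at `e₁` in the basis `{e₁, e₂, e₃, e₄}`. -/
def c1 (a : HC) : ℂ := a.re - Complex.I * a.imI
/-- Coordinate at `e₂`. -/
def c2 (a : HC) : ℂ := a.re + Complex.I * a.imI
/-- Coordinate at `e₃`. -/
def c3 (a : HC) : ℂ := -(Complex.I * a.imJ) - a.imK
/-- Coordinate at `e₄`. -/
def c4 (a : HC) : ℂ := -(Complex.I * a.imJ) + a.imK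

/-- The norm `‖a‖ = √(|a₁|² + |a₂|² + |a₃|² + |a₄|²)`, coordinates in the basis `{e₁,e₂,e₃,e₄}`. -/
def qnorm (a : HC) : ℝ :=
  Real.sqrt (‖c1 a‖ ^ 2 + ‖c2 a‖ ^ 2 +
    ‖c3 a‖ ^ 2 + ‖c4 a‖ ^ 2)

/-- `f₁ : ℍ(ℂ) → ℂ`, the ℂ-linear functional with `f₁(e₁) = f₁(e₃) = 1`, `f₁(e₂) = f₁(e₄) = 0`. -/
def f1 (a : HC) : ℂ := c1 a + c3 a
/-- `f₂ : ℍ(ℂ) → ℂ`, with `f₂(e₂) = f₂(e₄) = 1`, `f₂(e₁) = f₂(e₃) = 0`. -/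
def f2 (a : HC) : ℂ := c2 a + c4 a
/-- `f̂₁ : ℍ(ℂ) → ℂ`, with `f̂₁(e₁) = f̂₁(e₄) = 1`, `f̂₁(e₂) = f̂₁(e₃) = 0`. -/
def fh1 (a : HC) : ℂ := c1 a + c4 a
/-- `f̂₂ : ℍ(ℂ) → ℂ`, with `f̂₂(e₂) = f̂₂(e₃) = 1`, `f̂₂(e₁) = f̂₂(e₄) = 0`. -/
def fh2 (a : HC) : ℂ := c2 a + c3 a

/-- `ζ = x i₁ + y i₂ + z i₃` for `p = (x, y, z) ∈ ℝ³` (with `i₁ = 1`). -/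
def zeta (i2 i3 : HC) (p : ℝ × ℝ × ℝ) : HC :=
  (p.1 : ℂ) • (1 : HC) + (p.2.1 : ℂ) • i2 + (p.2.2 : ℂ) • i3

/-- The real linear span `E₃` of `i₁ = 1, i₂, i₃`. -/
def E3 (i2 i3 : HC) : Set HC := Set.range (zeta i2 i3)

/-- `i₁ = 1, i₂, i₃` are linearly independent over `ℝ`. -/
def LinIndep (i2 i3 : HC) : Prop :=
  ∀ α₁ α₂ α₃ : ℝ, (α₁ : ℂ) • (1 : HC) + (α₂ : ℂ) • i2 + (α₃ : ℂ) • i3 = 0 →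
    α₁ = 0 ∧ α₂ = 0 ∧ α₃ = 0

/-- `Φ` is right-G-monogenic on `S` (w.r.t. directions in `E₃`): it is continuous on `S` and at
every `ζ ∈ S` there is `Φ'(ζ)` with `lim_{ε→0+} (Φ(ζ+εh) − Φ(ζ))ε⁻¹ = h·Φ'(ζ)` for all `h ∈ E₃`. -/
def RightGMonogenic (i2 i3 : HC) (Φ : HC → HC) (S : Set HC) : Prop :=
  ContinuousOn Φ S ∧ ∀ ζ ∈ S, ∃ Φ' : HC, ∀ h ∈ E3 i2 i3,
    Tendsto (fun ε : ℝ => ((ε : ℂ))⁻¹ • (Φ (ζ + (ε : ℂ) • h) - Φ ζ))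
      (nhdsWithin 0 (Set.Ioi 0)) (nhds (h * Φ'))

/-- `Φ̂` is left-G-monogenic on `S`. -/
def LeftGMonogenic (i2 i3 : HC) (Φ : HC → HC) (S : Set HC) : Prop :=
  ContinuousOn Φ S ∧ ∀ ζ ∈ S, ∃ Φ' : HC, ∀ h ∈ E3 i2 i3,
    Tendsto (fun ε : ℝ => ((ε : ℂ))⁻¹ • (Φ (ζ + (ε : ℂ) • h) - Φ ζ))
      (nhdsWithin 0 (Set.Ioi 0)) (nhds (Φ' * h))

/-- The right maximal ideal `𝓘₁ = {λ₂e₂ + λ₄e₄}`. -/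
def I1 : Set HC := {a | ∃ l2 l4 : ℂ, a = l2 • e2 + l4 • e4}
/-- The right maximal ideal `𝓘₂ = {λ₁e₁ + λ₃e₃}`. -/
def I2 : Set HC := {a | ∃ l1 l3 : ℂ, a = l1 • e1 + l3 • e3}
/-- The left maximal ideal `𝓘̂₁ = {λ₂e₂ + λ₃e₃}`. -/
def Ih1 : Set HC := {a | ∃ l2 l3 : ℂ, a = l2 • e2 + l3 • e3}
/-- The left maximal ideal `𝓘̂₂ = {λ₁e₁ + λ₄e₄}`. -/
def Ih2 : Set HC := {a | ∃ l1 l4 : ℂ, a = l1 • e1 + l4 • e4}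

/-- The line `L` in `ℝ³` given by `x + y·Re a + z·Re b = 0`, `y·Im a + z·Im b = 0`. -/
def lineL (a b : ℂ) : Set (ℝ × ℝ × ℝ) :=
  {p | p.1 + p.2.1 * a.re + p.2.2 * b.re = 0 ∧ p.2.1 * a.im + p.2.2 * b.im = 0}

/-- `Ω` is convex in the direction of the line `L` (a line through the origin): it contains every
segment parallel to `L` joining two of its points. -/
def ConvexInDirection (Ω : Set (ℝ × ℝ × ℝ)) (L : Set (ℝ × ℝ × ℝ)) : Prop :=
  ∀ p ∈ Ω, ∀ q ∈ Ω, q - p ∈ L → segment ℝ p q ⊆ Ω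

/-- `ξ = x + y·a + z·b` for `p = (x,y,z)`. -/
def xi (a b : ℂ) (p : ℝ × ℝ × ℝ) : ℂ := (p.1 : ℂ) + (p.2.1 : ℂ) * a + (p.2.2 : ℂ) * b


/-- `Φ'` is a right Gateaux derivative of `Φ` on `S` (directions in `E₃`). -/
def IsRightGDeriv (i2 i3 : HC) (Φ Φ' : HC → HC) (S : Set HC) : Prop :=
  ∀ ζ ∈ S, ∀ h ∈ E3 i2 i3,
    Tendsto (fun ε : ℝ => ((ε : ℂ))⁻¹ • (Φ (ζ + (ε : ℂ) • h) - Φ ζ))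
      (nhdsWithin 0 (Set.Ioi 0)) (nhds (h * Φ' ζ))

/-- `Φ'` is a left Gateaux derivative of `Φ` on `S`. -/
def IsLeftGDeriv (i2 i3 : HC) (Φ Φ' : HC → HC) (S : Set HC) : Prop :=
  ∀ ζ ∈ S, ∀ h ∈ E3 i2 i3,
    Tendsto (fun ε : ℝ => ((ε : ℂ))⁻¹ • (Φ (ζ + (ε : ℂ) • h) - Φ ζ))
      (nhdsWithin 0 (Set.Ioi 0)) (nhds (Φ' ζ * h))

/-- Triples `(α, β, γ)` of naturals with `α + β + γ = n`. -/
def trip (n : ℕ) : Finset (ℕ × ℕ × ℕ) :=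
  (Finset.range (n + 1) ×ˢ Finset.range (n + 1) ×ˢ Finset.range (n + 1)).filter
    (fun u => u.1 + u.2.1 + u.2.2 = n)


/-- Complex-linear one-sided Gateaux derivative at a point. -/
def GD (F : ℂ → ℂ) (c z : ℂ) : Prop :=
  ∀ η : ℂ, Tendsto (fun ε : ℝ => (ε : ℂ)⁻¹ * (F (z + (ε : ℂ) * η) - F z)) (𝓝[>] 0) (𝓝 (η * c))

lemma GD_bound {F : ℂ → ℂ} {c z : ℂ} (h : GD F c z) (η : ℂ) :
    ∃ δ > 0, ∃ C : ℝ, ∀ t : ℝ, 0 ≤ t → t ≤ δ → ‖F (z + (t : ℂ) * η) - F z‖ ≤ C * t := by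
  have h1 := (h η).norm
  have h2 : ∀ᶠ ε : ℝ in 𝓝[>] 0, ‖(ε : ℂ)⁻¹ * (F (z + (ε : ℂ) * η) - F z)‖ < ‖η * c‖ + 1 :=
    h1.eventually (gt_mem_nhds (by linarith))
  rw [eventually_nhdsWithin_iff, Metric.eventually_nhds_iff] at h2
  obtain ⟨δ, hδ, h3⟩ := h2
  refine ⟨δ / 2, by positivity, ‖η * c‖ + 1, fun t ht0 ht => ?_⟩
  rcases ht0.eq_or_lt with rfl | htp
  · simp
  have h4 := h3 (y := t) (by rw [Real.dist_eq, sub_zero, abs_of_pos htp]; linarith) htp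
  rw [norm_mul, norm_inv, Complex.norm_real, Real.norm_of_nonneg ht0, inv_mul_lt_iff₀ htp] at h4
  linarith

lemma diff_of_lip {F : ℂ → ℂ} {z0 : ℂ} {r : ℝ} {K : ℝ} (hK : 0 ≤ K)
    (hL : ∀ z ∈ Metric.ball z0 r, ∀ w ∈ Metric.ball z0 r, ‖F z - F w‖ ≤ K * ‖z - w‖)
    {z c : ℂ} (hz : z ∈ Metric.ball z0 r) (h : GD F c z) : DifferentiableAt ℂ F z := by
  have hl : LipschitzOnWith ⟨K, hK⟩ F (Metric.ball z0 r) := by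
    refine LipschitzOnWith.of_dist_le_mul fun x hx y hy => ?_
    rw [dist_eq_norm, dist_eq_norm]; exact hL x hx y hy
  obtain ⟨g, hg, hFg⟩ := hl.extend_finite_dimension
  have hnb : Metric.ball z0 r ∈ 𝓝 z := Metric.isOpen_ball.mem_nhds hz
  have hev : F =ᶠ[𝓝 z] g := by filter_upwards [hnb] with w hw using hFg hw
  have key : ∀ η : ℂ, HasDerivWithinAt (fun t : ℝ => g (z + t • η)) (η * c) (Ioi 0) 0 := by
    intro η
    rw [hasDerivWithinAt_iff_tendsto_slope' (by simp)]
    refine (h η).congr' ?_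
    have hc : Tendsto (fun t : ℝ => z + (t : ℂ) * η) (𝓝[>] 0) (𝓝 z) := by
      have : Continuous (fun t : ℝ => z + (t : ℂ) * η) := by fun_prop
      have := this.tendsto 0
      simp only [Complex.ofReal_zero, zero_mul, add_zero] at this
      exact this.mono_left nhdsWithin_le_nhds
    filter_upwards [hc.eventually hev] with t ht
    simp [slope_def_module, ht, hev.self_of_nhds]
  have hline : ∀ η : ℂ, HasLineDerivAt ℝ g (η * c) z η := by
    intro η
    unfold HasLineDerivAt
    have h1 := key η
    have h2 := key (-η)
    have h3 : HasDerivWithinAt (fun t : ℝ => g (z + t • η)) (η * c) (Iio 0) 0 := by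
      have h4 : HasDerivWithinAt (fun t : ℝ => -t) (-1) (Iio 0) (0 : ℝ) := by
        exact (hasDerivAt_neg (0 : ℝ)).hasDerivWithinAt
      have h5 := HasDerivWithinAt.scomp (0 : ℝ) (t' := Ioi 0) (h := fun t : ℝ => -t)
        (g₁ := fun t : ℝ => g (z + t • (-η))) (by simpa using h2) h4
        (by intro t ht; simpa using ht)
      simpa [Function.comp_def] using h5
    have h6 := h3.union h1
    have h7 : HasDerivWithinAt (fun t : ℝ => g (z + t • η)) (η * c) (Iio 0 ∪ Ioi 0) 0 := h6
    have h8 : (Iio 0 ∪ Ioi 0 : Set ℝ) = univ \ {0} := by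
      ext x
      simp only [mem_union, mem_Iio, mem_Ioi, Set.mem_sdiff, mem_univ, mem_singleton_iff, true_and]
      exact lt_or_lt_iff_ne
    rw [h8, hasDerivWithinAt_sdiff_singleton] at h7
    exact hasDerivWithinAt_univ.1 h7
  have hf : HasFDerivAt g ((ContinuousLinearMap.toSpanSingleton ℂ c).restrictScalars ℝ) z :=
    hg.hasFDerivAt_of_hasLineDerivAt_of_closure (s := univ) (by simp)
      (fun v _ => by simpa using hline v)
  have hf2 : HasFDerivAt g (ContinuousLinearMap.toSpanSingleton ℂ c) z :=
    hasFDerivAt_of_restrictScalars ℝ hf rfl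
  exact (hf2.congr_of_eventuallyEq hev).differentiableAt

lemma step2 {F : ℂ → ℂ} {b0 b : ℂ} {R K : ℝ} (hR : 0 < R) {B : Set ℂ}
    (σ : ℝ) (hσ : σ = 1 ∨ σ = -1)
    (hBo : IsOpen (Metric.ball b0 R \ B))
    (hF : ContinuousOn F (Metric.closedBall b0 R))
    (hd : DifferentiableOn ℂ F (Metric.ball b0 R \ B))
    (h1 : ∀ w, ‖w - b0‖ = R → ‖F w - F b‖ ≤ K * ‖w - b‖)
    (h2 : ∀ w ∈ Metric.ball b0 R, w ∈ B → ‖F w - F b‖ ≤ K * ‖w - b‖)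
    (h3 : ∀ w ∈ Metric.ball b0 R, w.re = b.re → ‖F w - F b‖ ≤ K * ‖w - b‖)
    (hK : 0 ≤ K)
    {w : ℂ} (hw : w ∈ Metric.ball b0 R) (hwσ : 0 < σ * (w - b).re) :
    ‖F w - F b‖ ≤ K * ‖w - b‖ := by
  by_cases hwB : w ∈ B
  · exact h2 w hw hwB
  set D : Set ℂ := (Metric.ball b0 R \ B) ∩ {w | 0 < σ * (w - b).re} with hD
  have hDo : IsOpen D := hBo.inter (isOpen_lt (by fun_prop) (by fun_prop))
  have hcl : closure D ⊆ Metric.closedBall b0 R ∩ {w | 0 ≤ σ * (w - b).re} := by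
    refine closure_minimal ?_ (Metric.isClosed_closedBall.inter
      (isClosed_le (by fun_prop) (by fun_prop)))
    rintro x ⟨⟨hx1, -⟩, hx2⟩
    exact ⟨Metric.ball_subset_closedBall hx1, by
      simp only [mem_ofPred_eq] at hx2 ⊢; exact hx2.le⟩
  have hnorm : ∀ δ : ℝ, 0 < δ → ∀ x : ℂ, 0 ≤ σ * (x - b).re →
      ‖x - b‖ ≤ ‖x - b + (σ * δ : ℝ)‖ ∧ x - b + (σ * δ : ℝ) ≠ 0 := by
    intro δ hδ x hx
    have hs : σ * σ = 1 := by rcases hσ with h | h <;> rw [h] <;> norm_num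
    constructor
    · rw [← sq_le_sq₀ (norm_nonneg _) (norm_nonneg _), Complex.sq_norm, Complex.sq_norm,
        Complex.normSq_apply, Complex.normSq_apply]
      simp only [Complex.add_re, Complex.add_im, Complex.ofReal_re, Complex.ofReal_im, add_zero]
      nlinarith [mul_nonneg hδ.le hx]
    · intro h0
      have := congrArg Complex.re h0
      simp only [Complex.add_re, Complex.ofReal_re, Complex.zero_re] at this
      have h4 : σ * ((x - b).re + σ * δ) = 0 := by rw [this, mul_zero]
      nlinarith
  have hmax : ∀ δ : ℝ, 0 < δ → ‖F w - F b‖ ≤ K * ‖w - b + (σ * δ : ℝ)‖ := by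
    intro δ hδ
    have hdc : DiffContOnCl ℂ (fun x => (F x - F b) / (x - b + (σ * δ : ℝ))) D := by
      constructor
      · refine DifferentiableOn.div ?_ (by fun_prop) ?_
        · exact (hd.mono inter_subset_left).sub_const _
        · intro x hx; exact (hnorm δ hδ x (le_of_lt hx.2)).2
      · refine ContinuousOn.div ?_ (by fun_prop) ?_
        · exact (hF.mono (fun x hx => (hcl hx).1)).sub continuousOn_const
        · intro x hx; exact (hnorm δ hδ x (hcl hx).2).2
    have := Complex.norm_le_of_forall_mem_frontier_norm_le
      (Metric.isBounded_ball.subset (inter_subset_left.trans sdiff_subset)) hdc (C := K) ?_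
      (subset_closure (⟨⟨hw, hwB⟩, hwσ⟩ : w ∈ D))
    · rw [norm_div, div_le_iff₀ (norm_pos_iff.2 (hnorm δ hδ w hwσ.le).2)] at this
      exact this
    · intro x hx
      rw [hDo.frontier_eq] at hx
      have hx1 := hcl hx.1
      have hx3 := hnorm δ hδ x hx1.2
      rw [norm_div, div_le_iff₀ (norm_pos_iff.2 hx3.2)]
      have : ‖F x - F b‖ ≤ K * ‖x - b‖ := by
        have hx4 := hx1.1
        rw [Metric.mem_closedBall, dist_eq_norm] at hx4
        rcases hx4.eq_or_lt with he | hlt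
        · exact h1 x he
        · have hxb : x ∈ Metric.ball b0 R := by rwa [Metric.mem_ball, dist_eq_norm]
          by_cases hxB : x ∈ B
          · exact h2 x hxb hxB
          · refine h3 x hxb ?_
            have h5 : ¬ (0 < σ * (x - b).re) := fun h => hx.2 ⟨⟨hxb, hxB⟩, h⟩
            have h6 : σ * (x - b).re = 0 := le_antisymm (not_lt.1 h5) hx1.2
            have h7 : (x - b).re = 0 := by
              rcases hσ with h | h <;> rw [h] at h6 <;> linarith
            rw [Complex.sub_re] at h7; linarith
      exact this.trans (mul_le_mul_of_nonneg_left hx3.1 hK)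
  have hlim : Tendsto (fun δ : ℝ => K * ‖w - b + (σ * δ : ℝ)‖) (𝓝[>] 0) (𝓝 (K * ‖w - b‖)) := by
    have : Continuous (fun δ : ℝ => K * ‖w - b + (σ * δ : ℝ)‖) := by fun_prop
    have := this.tendsto 0
    simp only [mul_zero, Complex.ofReal_zero, add_zero] at this
    exact this.mono_left nhdsWithin_le_nhds
  refine ge_of_tendsto hlim ?_
  filter_upwards [self_mem_nhdsWithin] with δ hδ using hmax δ hδ

lemma step3 {F : ℂ → ℂ} {b0 w0 : ℂ} {R K : ℝ} {B : Set ℂ}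
    (hBo : IsOpen (Metric.ball b0 R \ B))
    (hF : ContinuousOn F (Metric.closedBall b0 R))
    (hd : DifferentiableOn ℂ F (Metric.ball b0 R \ B))
    (hw0 : w0 ∈ Metric.ball b0 R \ B)
    (h1 : ∀ w, ‖w - b0‖ = R → ‖F w - F w0‖ ≤ K * ‖w - w0‖)
    (h2 : ∀ w ∈ Metric.ball b0 R, w ∈ B → ‖F w - F w0‖ ≤ K * ‖w - w0‖)
    {w : ℂ} (hw : w ∈ Metric.ball b0 R \ B) :
    ‖F w - F w0‖ ≤ K * ‖w - w0‖ := by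
  rcases eq_or_ne w w0 with rfl | hne
  · simp
  have hcl : closure (Metric.ball b0 R \ B) ⊆ Metric.closedBall b0 R :=
    closure_minimal (sdiff_subset.trans Metric.ball_subset_closedBall) Metric.isClosed_closedBall
  have hnb := hBo.mem_nhds hw0
  have hdc : DiffContOnCl ℂ (dslope F w0) (Metric.ball b0 R \ B) := by
    constructor
    · exact (Complex.differentiableOn_dslope hnb).2 hd
    · exact (continuousOn_dslope (mem_of_superset hnb subset_closure)).2
        ⟨hF.mono hcl, hd.differentiableAt hnb⟩
  have hsl : ∀ x, x ≠ w0 → ‖F x - F w0‖ = ‖dslope F w0 x‖ * ‖x - w0‖ := by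
    intro x hx
    rw [← norm_mul, mul_comm, ← smul_eq_mul, sub_smul_dslope]
  have := Complex.norm_le_of_forall_mem_frontier_norm_le
      (Metric.isBounded_ball.subset sdiff_subset) hdc (C := K) ?_ (subset_closure hw)
  · rw [hsl w hne]
    exact mul_le_mul_of_nonneg_right this (norm_nonneg _)
  · intro x hx
    rw [hBo.frontier_eq] at hx
    have hxne : x ≠ w0 := by rintro rfl; exact hx.2 hw0
    have hx4 := hcl hx.1
    rw [Metric.mem_closedBall, dist_eq_norm] at hx4
    have : ‖F x - F w0‖ ≤ K * ‖x - w0‖ := by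
      rcases hx4.eq_or_lt with he | hlt
      · exact h1 x he
      · have hxb : x ∈ Metric.ball b0 R := by rwa [Metric.mem_ball, dist_eq_norm]
        by_cases hxB : x ∈ B
        · exact h2 x hxb hxB
        · exact absurd ⟨hxb, hxB⟩ hx.2
    rw [hsl x hxne] at this
    exact le_of_mul_le_mul_right this (norm_pos_iff.2 (sub_ne_zero.2 hxne))

lemma holo_of_GD {F : ℂ → ℂ} {U : Set ℂ} (hU : IsOpen U) (hF : ContinuousOn F U)
    (c : ℂ → ℂ) (h : ∀ z ∈ U, GD F (c z) z) {z0 : ℂ} (hz0 : z0 ∈ U) : AnalyticAt ℂ F z0 := by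
  by_contra hbad
  set B : Set ℂ := {z | ¬ AnalyticAt ℂ F z} with hB
  have hBc : IsClosed B := (isOpen_analyticAt ℂ F).isClosed_compl
  obtain ⟨r', hr', hrU⟩ := Metric.isOpen_iff.1 hU z0 hz0
  obtain ⟨r, hr, hr4⟩ : ∃ r > 0, 4 * r = r' := ⟨r' / 4, by positivity, by ring⟩
  set C : Set ℂ := B ∩ Metric.closedBall z0 r with hC
  have hCc : IsClosed C := hBc.inter Metric.isClosed_closedBall
  have : CompleteSpace C := hCc.isComplete.completeSpace_coe
  let dirs : Set ℂ := {1, -1, Complex.I, -Complex.I}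
  have hdirs : ∀ η ∈ dirs, ‖η‖ = 1 := by
    rintro η (rfl | rfl | rfl | rfl) <;> simp
  let E : ℕ → Set C := fun n => {z | ∀ t : ℝ, 0 ≤ t → t ≤ r / (n + 1) → ∀ η ∈ dirs,
    ‖F ((z : ℂ) + (t : ℂ) * η) - F z‖ ≤ n * t}
  have hEc : ∀ n, IsClosed (E n) := by
    intro n
    simp only [E, ofPred_forall]
    refine isClosed_iInter fun t => isClosed_iInter fun ht0 => isClosed_iInter fun ht =>
      isClosed_iInter fun η => isClosed_iInter fun hη => isClosed_le ?_ continuous_const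
    have htr : t ≤ r := ht.trans (div_le_self hr.le (by linarith [n.cast_nonneg (α := ℝ)]))
    have hc1 : Continuous (fun z : C => F ((z : ℂ) + (t : ℂ) * η)) := by
      refine hF.comp_continuous (by fun_prop) fun z => hrU ?_
      rw [Metric.mem_ball, dist_eq_norm]
      have h1 : ‖(z : ℂ) - z0‖ ≤ r := by simpa [dist_eq_norm] using z.2.2
      have h2 : ‖(t : ℂ) * η‖ ≤ r := by
        rw [norm_mul, hdirs η hη, mul_one, Complex.norm_real, Real.norm_of_nonneg ht0]; exact htr
      calc ‖(z : ℂ) + t * η - z0‖ = ‖((z : ℂ) - z0) + t * η‖ := by ring_nf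
        _ ≤ r + r := (norm_add_le _ _).trans (add_le_add h1 h2)
        _ < r' := by linarith
    have hc2 : Continuous (fun z : C => F (z : ℂ)) := by
      refine hF.comp_continuous (by fun_prop) fun z => hrU ?_
      have h1 : dist (z : ℂ) z0 ≤ r := z.2.2
      rw [Metric.mem_ball]; linarith
    exact (hc1.sub hc2).norm
  have hEU : ⋃ n, E n = univ := by
    refine eq_univ_of_forall fun z => mem_iUnion.2 ?_
    have hzU : (z : ℂ) ∈ U := hrU (by
      have h1 : dist (z : ℂ) z0 ≤ r := z.2.2
      rw [Metric.mem_ball]; linarith)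
    have hg := h z hzU
    choose δ hδ A hA using fun η => GD_bound hg η
    have hfin : dirs.Finite := by simp [dirs]
    have hev : ∀ᶠ n : ℕ in atTop, ∀ η ∈ dirs, r / ((n : ℝ) + 1) ≤ δ η ∧ A η ≤ n := by
      rw [hfin.eventually_all]
      intro η _
      have hl : Tendsto (fun n : ℕ => r / ((n : ℝ) + 1)) atTop (𝓝 0) := by
        have := (tendsto_one_div_add_atTop_nhds_zero_nat (𝕜 := ℝ)).const_mul r
        simpa [div_eq_mul_inv] using this
      exact (hl.eventually (ge_mem_nhds (hδ η))).and
        (tendsto_natCast_atTop_atTop.eventually_ge_atTop (A η))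
    obtain ⟨n, hn⟩ := hev.exists
    refine ⟨n, fun t ht0 ht η hη => ?_⟩
    exact (hA η t ht0 (ht.trans (hn η hη).1)).trans
      (mul_le_mul_of_nonneg_right (hn η hη).2 ht0)
  have hdense := dense_iUnion_interior_of_closed hEc hEU
  have hz0C : z0 ∈ C := ⟨hbad, by simp [hr.le]⟩
  obtain ⟨x, hx1, hx2⟩ := hdense.inter_open_nonempty
    {z : C | (z : ℂ) ∈ Metric.ball z0 r} (Metric.isOpen_ball.preimage continuous_subtype_val)
    ⟨⟨z0, hz0C⟩, by simp [hr]⟩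
  obtain ⟨n, hxn⟩ := mem_iUnion.1 hx2
  obtain ⟨ρ1, hρ1, hball1⟩ := Metric.isOpen_iff.1 isOpen_interior x hxn
  obtain ⟨ρ2, hρ2, hball2⟩ := Metric.isOpen_iff.1 Metric.isOpen_ball (x : ℂ) hx1
  obtain ⟨b0, hxb0, hb0B⟩ : ∃ b0 : ℂ, (x : ℂ) = b0 ∧ b0 ∈ B := ⟨x, rfl, x.2.1⟩
  rw [hxb0] at hball2
  -- a common radius
  obtain ⟨R, hR, hRa, hRb, hRc, hRd⟩ : ∃ R > 0, R ≤ ρ1 ∧ R < ρ2 ∧ 2 * R ≤ r / (n + 1) ∧ R ≤ r := by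
    have hp : 0 < r / ((n : ℝ) + 1) := by positivity
    refine ⟨min (min ρ1 (ρ2 / 2)) (min (r / (n + 1) / 2) r), by positivity, ?_, ?_, ?_, ?_⟩
    · exact (min_le_left _ _).trans (min_le_left _ _)
    · have := (min_le_left (min ρ1 (ρ2 / 2)) (min (r / ((n : ℝ) + 1) / 2) r)).trans
        (min_le_right _ _)
      linarith
    · have := (min_le_right (min ρ1 (ρ2 / 2)) (min (r / ((n : ℝ) + 1) / 2) r)).trans
        (min_le_left _ _)
      linarith
    · exact (min_le_right _ _).trans (min_le_right _ _)
  have hcbU : Metric.closedBall b0 R ⊆ U := by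
    intro w hw
    apply hrU
    have := hball2 (show w ∈ Metric.ball b0 ρ2 from lt_of_le_of_lt hw hRb)
    rw [Metric.mem_ball] at this ⊢; linarith
  have hFR : ContinuousOn F (Metric.closedBall b0 R) := hF.mono hcbU
  have hEb : ∀ b ∈ Metric.ball b0 R, b ∈ B → ∀ t : ℝ, 0 ≤ t → t ≤ 2 * R → ∀ η ∈ dirs,
      ‖F (b + (t : ℂ) * η) - F b‖ ≤ n * t := by
    intro b hb hbB t ht0 ht
    have hbC : b ∈ C := by
      refine ⟨hbB, Metric.ball_subset_closedBall (hball2 ?_)⟩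
      exact lt_trans hb hRb
    have : (⟨b, hbC⟩ : C) ∈ E n := by
      refine interior_subset (hball1 ?_)
      rw [Metric.mem_ball, Subtype.dist_eq, hxb0]
      exact lt_of_lt_of_le hb hRa
    exact this t ht0 (ht.trans hRc)
  have hEre : ∀ b ∈ Metric.ball b0 R, b ∈ B → ∀ s : ℝ, |s| ≤ 2 * R →
      ‖F (b + (s : ℂ)) - F b‖ ≤ n * |s| := by
    intro b hb hbB s hs
    rcases le_total 0 s with h0 | h0
    · rw [abs_of_nonneg h0] at hs ⊢
      simpa using hEb b hb hbB s h0 hs 1 (by simp [dirs])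
    · rw [abs_of_nonpos h0] at hs ⊢
      simpa using hEb b hb hbB (-s) (by linarith) hs (-1) (by simp [dirs])
  have hEim : ∀ b ∈ Metric.ball b0 R, b ∈ B → ∀ s : ℝ, |s| ≤ 2 * R →
      ‖F (b + (s : ℂ) * Complex.I) - F b‖ ≤ n * |s| := by
    intro b hb hbB s hs
    rcases le_total 0 s with h0 | h0
    · rw [abs_of_nonneg h0] at hs ⊢
      simpa using hEb b hb hbB s h0 hs Complex.I (by simp [dirs])
    · rw [abs_of_nonpos h0] at hs ⊢
      simpa using hEb b hb hbB (-s) (by linarith) hs (-Complex.I) (by simp [dirs])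
  have hdist : ∀ u ∈ Metric.ball b0 R, ∀ v ∈ Metric.ball b0 R, ‖u - v‖ ≤ 2 * R := by
    intro u hu v hv
    rw [← dist_eq_norm]
    have := dist_triangle_right u v b0
    rw [Metric.mem_ball] at hu hv; linarith
  have hvert : ∀ b ∈ Metric.ball b0 R, b ∈ B → ∀ w ∈ Metric.ball b0 R, w.re = b.re →
      ‖F w - F b‖ ≤ n * ‖w - b‖ := by
    intro b hb hbB w hw hre
    have h1 := (Complex.abs_im_le_norm (w - b))
    have h2 := hEim b hb hbB (w - b).im (h1.trans (hdist w hw b hb))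
    have h3 : b + ((w - b).im : ℂ) * Complex.I = w := by
      apply Complex.ext <;> simp [hre]
    rw [h3] at h2
    exact h2.trans (mul_le_mul_of_nonneg_left h1 n.cast_nonneg)
  have hlipB : ∀ b ∈ Metric.ball b0 R, b ∈ B → ∀ w ∈ Metric.ball b0 R, w ∈ B →
      ‖F w - F b‖ ≤ 2 * n * ‖w - b‖ := by
    intro b hb hbB w hw hwB
    have h1 := (Complex.abs_re_le_norm (w - b))
    have h2 := (Complex.abs_im_le_norm (b - w))
    have h3 := hEre b hb hbB (w - b).re (h1.trans (hdist w hw b hb))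
    have h4 := hEim w hw hwB (b - w).im (h2.trans (hdist b hb w hw))
    have h5 : w + ((b - w).im : ℂ) * Complex.I = b + ((w - b).re : ℂ) := by
      apply Complex.ext <;> simp
    rw [h5] at h4
    rw [norm_sub_rev b w] at h2
    have hn0 : (0 : ℝ) ≤ n := n.cast_nonneg
    calc ‖F w - F b‖ = ‖(F (b + ((w - b).re : ℂ)) - F b) - (F (b + ((w - b).re : ℂ)) - F w)‖ := by
          congr 1; ring
      _ ≤ n * ‖w - b‖ + n * ‖w - b‖ := (norm_sub_le _ _).trans (add_le_add
          (h3.trans (mul_le_mul_of_nonneg_left h1 hn0))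
          (h4.trans (mul_le_mul_of_nonneg_left h2 hn0)))
      _ = _ := by ring
  obtain ⟨M, hM⟩ := (isCompact_closedBall b0 R).exists_bound_of_continuousOn hFR
  have hM0 : 0 ≤ M := (norm_nonneg _).trans (hM b0 (by simp [hR.le]))
  set K : ℝ := max (2 * n) (8 * M / R) with hKdef
  have hK0 : 0 ≤ K := le_max_of_le_right (by positivity)
  have hKn : 2 * (n : ℝ) ≤ K := le_max_left _ _
  have hn0 : (0 : ℝ) ≤ n := n.cast_nonneg
  have hfar : ∀ u ∈ Metric.closedBall b0 R, ∀ v ∈ Metric.closedBall b0 R, R / 4 ≤ ‖u - v‖ →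
      ‖F u - F v‖ ≤ K * ‖u - v‖ := by
    intro u hu v hv huv
    have h1 : ‖F u - F v‖ ≤ 2 * M := (norm_sub_le _ _).trans (by linarith [hM u hu, hM v hv])
    have h2 : 8 * M / R * (R / 4) = 2 * M := by field_simp; ring
    calc ‖F u - F v‖ ≤ 8 * M / R * (R / 4) := by rw [h2]; exact h1
      _ ≤ K * ‖u - v‖ := mul_le_mul (le_max_right _ _) huv (by positivity) hK0
  have hopen : ∀ s, IsOpen (Metric.ball b0 s \ B) := fun s => Metric.isOpen_ball.sdiff hBc
  have hdiff : ∀ s, DifferentiableOn ℂ F (Metric.ball b0 s \ B) := by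
    intro s w hw
    have : AnalyticAt ℂ F w := not_not.1 hw.2
    exact this.differentiableAt.differentiableWithinAt
  have hS2 : ∀ b ∈ Metric.ball b0 (R / 2), b ∈ B → ∀ w ∈ Metric.ball b0 R,
      ‖F w - F b‖ ≤ K * ‖w - b‖ := by
    intro b hb hbB w hw
    have hbR : b ∈ Metric.ball b0 R := Metric.ball_subset_ball (by linarith) hb
    have h1 : ∀ w, ‖w - b0‖ = R → ‖F w - F b‖ ≤ K * ‖w - b‖ := by
      intro w hw
      refine hfar w (by simp [dist_eq_norm, hw]) b (Metric.ball_subset_closedBall hbR) ?_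
      rw [Metric.mem_ball, dist_eq_norm] at hb
      have := norm_sub_le_norm_sub_add_norm_sub w b b0
      linarith
    have h2 : ∀ w ∈ Metric.ball b0 R, w ∈ B → ‖F w - F b‖ ≤ K * ‖w - b‖ := fun w hw hwB =>
      (hlipB b hbR hbB w hw hwB).trans (mul_le_mul_of_nonneg_right hKn (norm_nonneg _))
    have h3 : ∀ w ∈ Metric.ball b0 R, w.re = b.re → ‖F w - F b‖ ≤ K * ‖w - b‖ := fun w hw hwr =>
      (hvert b hbR hbB w hw hwr).trans
        (mul_le_mul_of_nonneg_right (by linarith) (norm_nonneg _))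
    rcases lt_trichotomy 0 (w - b).re with hlt | heq | hgt
    · exact step2 hR 1 (Or.inl rfl) (hopen R) hFR (hdiff R) h1 h2 h3 hK0 hw (by simpa using hlt)
    · exact h3 w hw (by rw [Complex.sub_re] at heq; linarith)
    · exact step2 hR (-1) (Or.inr rfl) (hopen R) hFR (hdiff R) h1 h2 h3 hK0 hw (by linarith)
  have hlip : ∀ z ∈ Metric.ball b0 (R / 4), ∀ w ∈ Metric.ball b0 (R / 4),
      ‖F z - F w‖ ≤ K * ‖z - w‖ := by
    intro z hz w hw
    have hz2 : z ∈ Metric.ball b0 (R / 2) := Metric.ball_subset_ball (by linarith) hz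
    have hw2 : w ∈ Metric.ball b0 (R / 2) := Metric.ball_subset_ball (by linarith) hw
    have hzR : z ∈ Metric.ball b0 R := Metric.ball_subset_ball (by linarith) hz
    have hwR : w ∈ Metric.ball b0 R := Metric.ball_subset_ball (by linarith) hw
    by_cases hwB : w ∈ B
    · exact hS2 w hw2 hwB z hzR
    by_cases hzB : z ∈ B
    · rw [norm_sub_rev, norm_sub_rev z w]; exact hS2 z hz2 hzB w hwR
    refine step3 (hopen (R / 2)) (hFR.mono (Metric.closedBall_subset_closedBall (by linarith)))
      (hdiff _) ⟨hw2, hwB⟩ ?_ ?_ ⟨hz2, hzB⟩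
    · intro x hx
      refine hfar x (by simp [dist_eq_norm, hx]; linarith) w (Metric.ball_subset_closedBall hwR) ?_
      rw [Metric.mem_ball, dist_eq_norm] at hw
      have := norm_sub_le_norm_sub_add_norm_sub x w b0
      linarith
    · intro x hx hxB
      rw [norm_sub_rev, norm_sub_rev x w]
      exact hS2 x hx hxB w hwR
  have hdF : DifferentiableOn ℂ F (Metric.ball b0 (R / 4)) := by
    intro z hz
    have hzU : z ∈ U := hcbU (Metric.ball_subset_closedBall (Metric.ball_subset_ball (by linarith) hz))
    exact (diff_of_lip hK0 hlip hz (h z hzU)).differentiableWithinAt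
  exact hb0B (hdF.analyticAt (Metric.ball_mem_nhds b0 (by positivity)))

lemma tendsto_comp_lin {E : Type*} [NormedAddCommGroup E] [NormedSpace ℝ E] (ξ : E →L[ℝ] ℂ)
    {G : ℂ → ℂ} {p : E} (hG : DifferentiableAt ℂ G (ξ p)) (h : E) :
    Tendsto (fun ε : ℝ => (ε : ℂ)⁻¹ * (G (ξ (p + ε • h)) - G (ξ p))) (𝓝[>] 0)
      (𝓝 (ξ h * deriv G (ξ p))) := by
  have h1 : HasDerivAt (fun t : ℝ => ξ p + (t : ℂ) * ξ h) (ξ h) 0 := by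
    have := (Complex.ofRealCLM.hasDerivAt (x := (0 : ℝ))).mul_const (ξ h)
    simpa using this.const_add (ξ p)
  have h2 : HasDerivAt (fun t : ℝ => G (ξ p + (t : ℂ) * ξ h)) (ξ h * deriv G (ξ p)) 0 := by
    have h3 : HasDerivAt G (deriv G (ξ p)) (ξ p + ((0 : ℝ) : ℂ) * ξ h) := by
      simpa using hG.hasDerivAt
    have := HasDerivAt.scomp (0 : ℝ) h3 h1
    simpa [Function.comp_def] using this
  have h4 := hasDerivWithinAt_iff_tendsto_slope' (s := Ioi (0 : ℝ)) (by simp) |>.1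
    h2.hasDerivWithinAt
  refine h4.congr fun t => ?_
  simp [slope_def_module]

lemma scalar3 {E : Type*} [NormedAddCommGroup E] [NormedSpace ℝ E] (ξ : E →L[ℝ] ℂ)
    (s : ℂ →L[ℝ] E) (hs : ∀ w, ξ (s w) = w) {Ω : Set E} (hΩ : IsOpen Ω) {U V : E → ℂ}
    (hU : ContinuousOn U Ω)
    (hd : ∀ p ∈ Ω, ∀ h, Tendsto (fun ε : ℝ => (ε : ℂ)⁻¹ * (U (p + ε • h) - U p)) (𝓝[>] 0)
      (𝓝 (ξ h * V p))) :
    ContinuousOn V Ω ∧ ∃ W : E → ℂ, ∀ p ∈ Ω, ∀ h,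
      Tendsto (fun ε : ℝ => (ε : ℂ)⁻¹ * (V (p + ε • h) - V p)) (𝓝[>] 0) (𝓝 (ξ h * W p)) := by
  have main : ∀ p0 ∈ Ω, ∃ G : ℂ → ℂ, DifferentiableAt ℂ G (ξ p0) ∧ V =ᶠ[𝓝 p0] (fun p => G (ξ p)) := by
    intro p0 hp0
    obtain ⟨r, hr, hrΩ⟩ := Metric.isOpen_iff.1 hΩ p0 hp0
    let S : ℂ → E := fun w => p0 + s (w - ξ p0)
    have hScont : Continuous S := by fun_prop
    have hξS : ∀ w, ξ (S w) = w := by intro w; simp [S, hs]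
    have hS0 : S (ξ p0) = p0 := by simp [S]
    have hSadd : ∀ (w η : ℂ) (ε : ℝ), S (w + (ε : ℂ) * η) = S w + ε • s η := by
      intro w η ε
      have : w + (ε : ℂ) * η - ξ p0 = (w - ξ p0) + ε • η := by
        rw [Complex.real_smul]; ring
      simp only [S, this, map_add, map_smul, add_assoc]
    let F : ℂ → ℂ := fun w => U (S w)
    let O : Set ℂ := S ⁻¹' Metric.ball p0 r
    have hO : IsOpen O := Metric.isOpen_ball.preimage hScont
    have hFan : ∀ w ∈ O, AnalyticAt ℂ F w := by
      intro w hw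
      refine holo_of_GD hO (hU.comp hScont.continuousOn fun x hx => hrΩ hx) (fun w => V (S w))
        ?_ hw
      intro z hz η
      have := hd (S z) (hrΩ hz) (s η)
      rw [hs] at this
      refine this.congr fun ε => ?_
      change _ = (ε : ℂ)⁻¹ * (U (S (z + (ε : ℂ) * η)) - U (S z))
      rw [hSadd]
    let N : Set E := Metric.ball p0 r ∩ (fun p => S (ξ p)) ⁻¹' Metric.ball p0 r
    have hN : IsOpen N := Metric.isOpen_ball.inter
      (Metric.isOpen_ball.preimage (hScont.comp ξ.continuous))
    have hp0N : p0 ∈ N := by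
      refine ⟨by simp [hr], ?_⟩
      simp [hS0, hr]
    have hUF : ∀ p ∈ N, U p = F (ξ p) := by
      rintro p ⟨hp1, hp2⟩
      set q := S (ξ p) with hq
      have hker : ξ (p - q) = 0 := by rw [map_sub, hq, hξS, sub_self]
      have hseg : ∀ t ∈ Icc (0 : ℝ) 1, q + t • (p - q) ∈ Metric.ball p0 r := by
        intro t ht
        exact (convex_ball p0 r).add_smul_sub_mem hp2 hp1 ht
      have hconst := constant_of_has_deriv_right_zero (f := fun t : ℝ => U (q + t • (p - q)))
        (a := 0) (b := 1) ?_ ?_ 1 (by simp)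
      · simpa [F, ← hq] using hconst
      · exact hU.comp (by fun_prop) fun t ht => hrΩ (hseg t ht)
      · intro t ht
        have h1 := hd _ (hrΩ (hseg t ⟨ht.1, ht.2.le⟩)) (p - q)
        rw [hker, zero_mul] at h1
        rw [← hasDerivWithinAt_Ioi_iff_Ici, hasDerivWithinAt_iff_tendsto_slope' (by simp)]
        have h2 : Tendsto (fun x : ℝ => x - t) (𝓝[>] t) (𝓝[>] 0) := by
          refine tendsto_nhdsWithin_iff.2 ⟨?_, ?_⟩
          · have : Continuous (fun x : ℝ => x - t) := by fun_prop
            have := this.tendsto t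
            rw [sub_self] at this
            exact this.mono_left nhdsWithin_le_nhds
          · filter_upwards [self_mem_nhdsWithin] with x hx
            simpa using hx
        refine (h1.comp h2).congr fun x => ?_
        have h3 : q + t • (p - q) + (x - t) • (p - q) = q + x • (p - q) := by
          rw [add_assoc, ← add_smul]; congr 2; ring
        simp only [Function.comp, slope_def_module, h3]
        rw [Complex.real_smul]; push_cast; rfl
    have hVF : ∀ p ∈ N, V p = deriv F (ξ p) := by
      intro p hp
      have h1 := hd p (hrΩ hp.1) (s 1)
      have h2 := tendsto_comp_lin ξ (hFan (ξ p) hp.2).differentiableAt (s 1)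
      have h3 : Tendsto (fun ε : ℝ => p + ε • s 1) (𝓝[>] 0) (𝓝 p) := by
        have : Continuous (fun ε : ℝ => p + ε • s 1) := by fun_prop
        have := this.tendsto 0
        rw [zero_smul, add_zero] at this
        exact this.mono_left nhdsWithin_le_nhds
      have h4 := tendsto_nhds_unique_of_eventuallyEq h1 h2 ?_
      · simpa [hs] using h4
      · filter_upwards [h3.eventually (hN.mem_nhds hp)] with ε hε
        rw [hUF _ hε, hUF p hp]
    refine ⟨deriv F, ?_, ?_⟩
    · exact (hFan _ hp0N.2).deriv.differentiableAt
    · filter_upwards [hN.mem_nhds hp0N] with p hp using hVF p hp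
  constructor
  · intro p hp
    obtain ⟨G, hG, hVG⟩ := main p hp
    have : ContinuousAt (fun p => G (ξ p)) p :=
      ContinuousAt.comp (f := ξ) hG.continuousAt ξ.continuous.continuousAt
    exact (this.congr hVG.symm).continuousWithinAt
  · choose! G hG hVG using main
    refine ⟨fun p => deriv (G p) (ξ p), fun p hp h => ?_⟩
    refine (tendsto_comp_lin ξ (hG p hp) h).congr' ?_
    have h3 : Tendsto (fun ε : ℝ => p + ε • h) (𝓝[>] 0) (𝓝 p) := by
      have : Continuous (fun ε : ℝ => p + ε • h) := by fun_prop
      have := this.tendsto 0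
      rw [zero_smul, add_zero] at this
      exact this.mono_left nhdsWithin_le_nhds
    filter_upwards [h3.eventually (hVG p hp)] with ε hε
    rw [hε, (hVG p hp).self_of_nhds]

/-- The real-linear map `p ↦ x + y a + z b`. -/
def xiL (a b : ℂ) : (ℝ × ℝ × ℝ) →L[ℝ] ℂ :=
  LinearMap.toContinuousLinearMap
    { toFun := xi a b
      map_add' := by intro p q; simp [xi]; ring
      map_smul' := by intro t p; simp [xi]; ring }

lemma xiL_apply (a b : ℂ) (p : ℝ × ℝ × ℝ) : xiL a b p = xi a b p := rfl

lemma xiL_section {a b : ℂ}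
    (h : a ∉ Set.range ((↑) : ℝ → ℂ) ∨ b ∉ Set.range ((↑) : ℝ → ℂ)) :
    ∃ s : ℂ →L[ℝ] (ℝ × ℝ × ℝ), ∀ w, xiL a b (s w) = w := by
  have him : a.im ≠ 0 ∨ b.im ≠ 0 := by
    rcases h with h | h
    · left; intro h0; exact h ⟨a.re, Complex.ext (by simp) (by simp [h0])⟩
    · right; intro h0; exact h ⟨b.re, Complex.ext (by simp) (by simp [h0])⟩
  have hsurj : Function.Surjective (xiL a b) := by
    intro w
    rcases him with h | h
    · refine ⟨(w.re - w.im / a.im * a.re, w.im / a.im, 0), ?_⟩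
      rw [xiL_apply]
      apply Complex.ext <;> simp [xi, h]
    · refine ⟨(w.re - w.im / b.im * b.re, 0, w.im / b.im), ?_⟩
      rw [xiL_apply]
      apply Complex.ext <;> simp [xi, h]
  obtain ⟨g, hg⟩ := (xiL a b).toLinearMap.exists_rightInverse_of_surjective
    (LinearMap.range_eq_top.2 hsurj)
  exact ⟨LinearMap.toContinuousLinearMap g, fun w => LinearMap.congr_fun hg w⟩

lemma cont_parts : Continuous (fun q : HC => (q.re, q.imI, q.imJ, q.imK)) :=
  continuous_induced_dom

lemma cont_c1 : Continuous c1 := by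
  have := cont_parts
  have h1 : Continuous (fun q : HC => q.re) := this.fst
  have h2 : Continuous (fun q : HC => q.imI) := this.snd.fst
  unfold c1; fun_prop

lemma cont_c2 : Continuous c2 := by
  have := cont_parts
  have h1 : Continuous (fun q : HC => q.re) := this.fst
  have h2 : Continuous (fun q : HC => q.imI) := this.snd.fst
  unfold c2; fun_prop

lemma cont_c3 : Continuous c3 := by
  have := cont_parts
  have h1 : Continuous (fun q : HC => q.imJ) := this.snd.snd.fst
  have h2 : Continuous (fun q : HC => q.imK) := this.snd.snd.snd
  unfold c3; fun_prop

lemma cont_c4 : Continuous c4 := by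
  have := cont_parts
  have h1 : Continuous (fun q : HC => q.imJ) := this.snd.snd.fst
  have h2 : Continuous (fun q : HC => q.imK) := this.snd.snd.snd
  unfold c4; fun_prop

/-- The element with given coordinates in the basis `e₁, e₂, e₃, e₄`. -/
def mkHC (u : ℂ × ℂ × ℂ × ℂ) : HC :=
  ⟨(u.1 + u.2.1) / 2, Complex.I * (u.1 - u.2.1) / 2, Complex.I * (u.2.2.1 + u.2.2.2) / 2,
    (u.2.2.2 - u.2.2.1) / 2⟩

lemma cont_mkHC : Continuous mkHC := by
  refine continuous_induced_rng.2 ?_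
  simp only [Function.comp_def, mkHC]
  fun_prop

lemma mkHC_c (q : HC) : mkHC (c1 q, c2 q, c3 q, c4 q) = q := by
  have hI := Complex.I_mul_I
  ext <;> simp only [mkHC, c1, c2, c3, c4]
  · ring
  · linear_combination (-q.imI) * hI
  · linear_combination (-q.imJ) * hI
  · ring

lemma c_mkHC (u : ℂ × ℂ × ℂ × ℂ) : c1 (mkHC u) = u.1 ∧ c2 (mkHC u) = u.2.1 ∧
    c3 (mkHC u) = u.2.2.1 ∧ c4 (mkHC u) = u.2.2.2 := by
  have hI := Complex.I_mul_I
  refine ⟨?_, ?_, ?_, ?_⟩ <;> simp only [mkHC, c1, c2, c3, c4]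
  · linear_combination (-(u.1 - u.2.1) / 2) * hI
  · linear_combination ((u.1 - u.2.1) / 2) * hI
  · linear_combination (-(u.2.2.1 + u.2.2.2) / 2) * hI
  · linear_combination (-(u.2.2.1 + u.2.2.2) / 2) * hI

lemma tendsto_HC {α : Type*} {l : Filter α} {f : α → HC} {a : HC}
    (h1 : Tendsto (fun x => c1 (f x)) l (𝓝 (c1 a))) (h2 : Tendsto (fun x => c2 (f x)) l (𝓝 (c2 a)))
    (h3 : Tendsto (fun x => c3 (f x)) l (𝓝 (c3 a))) (h4 : Tendsto (fun x => c4 (f x)) l (𝓝 (c4 a))) :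
    Tendsto f l (𝓝 a) := by
  have h := (cont_mkHC.tendsto (c1 a, c2 a, c3 a, c4 a)).comp
    (h1.prodMk_nhds (h2.prodMk_nhds (h3.prodMk_nhds h4)))
  rw [mkHC_c] at h
  exact h.congr fun x => mkHC_c (f x)

lemma c1_dq (k : ℂ) (p q : HC) : c1 (k • (p - q)) = k * (c1 p - c1 q) := by
  simp [c1]; ring
lemma c2_dq (k : ℂ) (p q : HC) : c2 (k • (p - q)) = k * (c2 p - c2 q) := by
  simp [c2]; ring
lemma c3_dq (k : ℂ) (p q : HC) : c3 (k • (p - q)) = k * (c3 p - c3 q) := by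
  simp [c3]; ring
lemma c4_dq (k : ℂ) (p q : HC) : c4 (k • (p - q)) = k * (c4 p - c4 q) := by
  simp [c4]; ring

lemma zeta_eq (a₁ a₂ b₁ b₂ : ℂ) (p : ℝ × ℝ × ℝ) :
    zeta (a₁ • e1 + a₂ • e2) (b₁ • e1 + b₂ • e2) p = mkHC (xi a₁ b₁ p, xi a₂ b₂ p, 0, 0) := by
  ext <;> simp [zeta, mkHC, xi, e1, e2] <;> ring

lemma zeta_add (i2 i3 : HC) (p h : ℝ × ℝ × ℝ) (ε : ℝ) :
    zeta i2 i3 p + (ε : ℂ) • zeta i2 i3 h = zeta i2 i3 (p + ε • h) := by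
  ext <;> simp [zeta] <;> ring

lemma mul_right_c (u v : ℂ) (q : HC) :
    c1 (mkHC (u, v, 0, 0) * q) = u * c1 q ∧ c2 (mkHC (u, v, 0, 0) * q) = v * c2 q ∧
    c3 (mkHC (u, v, 0, 0) * q) = u * c3 q ∧ c4 (mkHC (u, v, 0, 0) * q) = v * c4 q := by
  have hI := Complex.I_sq
  refine ⟨?_, ?_, ?_, ?_⟩ <;>
  · simp [mkHC, c1, c2, c3, c4]
    ring_nf
    simp only [Complex.I_sq]
    ring

lemma mul_left_c (u v : ℂ) (q : HC) :
    c1 (q * mkHC (u, v, 0, 0)) = u * c1 q ∧ c2 (q * mkHC (u, v, 0, 0)) = v * c2 q ∧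
    c3 (q * mkHC (u, v, 0, 0)) = v * c3 q ∧ c4 (q * mkHC (u, v, 0, 0)) = u * c4 q := by
  refine ⟨?_, ?_, ?_, ?_⟩ <;>
  · simp [mkHC, c1, c2, c3, c4]
    ring_nf
    simp only [Complex.I_sq]
    ring

lemma gen_step (i2 i3 : HC) (op : HC → HC → HC) (inv : HC → ℝ × ℝ × ℝ) (hinvc : Continuous inv)
    (hinv : ∀ p, inv (zeta i2 i3 p) = p)
    (m1 m2 m3 m4 : (ℝ × ℝ × ℝ) →L[ℝ] ℂ) (s1 s2 s3 s4 : ℂ →L[ℝ] (ℝ × ℝ × ℝ))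
    (hs1 : ∀ w, m1 (s1 w) = w) (hs2 : ∀ w, m2 (s2 w) = w)
    (hs3 : ∀ w, m3 (s3 w) = w) (hs4 : ∀ w, m4 (s4 w) = w)
    (ho1 : ∀ p q, c1 (op (zeta i2 i3 p) q) = m1 p * c1 q)
    (ho2 : ∀ p q, c2 (op (zeta i2 i3 p) q) = m2 p * c2 q)
    (ho3 : ∀ p q, c3 (op (zeta i2 i3 p) q) = m3 p * c3 q)
    (ho4 : ∀ p q, c4 (op (zeta i2 i3 p) q) = m4 p * c4 q)
    (Ω : Set (ℝ × ℝ × ℝ)) (hΩ : IsOpen Ω) (Φ Φ' : HC → HC)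
    (hc : ContinuousOn Φ (zeta i2 i3 '' Ω))
    (hd : ∀ ζ ∈ zeta i2 i3 '' Ω, ∀ h ∈ E3 i2 i3,
      Tendsto (fun ε : ℝ => ((ε : ℂ))⁻¹ • (Φ (ζ + (ε : ℂ) • h) - Φ ζ))
        (nhdsWithin 0 (Set.Ioi 0)) (nhds (op h (Φ' ζ)))) :
    ContinuousOn Φ' (zeta i2 i3 '' Ω) ∧ ∃ Φ'' : HC → HC, ∀ ζ ∈ zeta i2 i3 '' Ω, ∀ h ∈ E3 i2 i3,
      Tendsto (fun ε : ℝ => ((ε : ℂ))⁻¹ • (Φ' (ζ + (ε : ℂ) • h) - Φ' ζ))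
        (nhdsWithin 0 (Set.Ioi 0)) (nhds (op h (Φ'' ζ))) := by
  have hzc : Continuous (zeta i2 i3) := by
    refine continuous_induced_rng.2 ?_
    simp only [Function.comp_def, zeta, QuaternionAlgebra.re_add, QuaternionAlgebra.imI_add,
      QuaternionAlgebra.imJ_add, QuaternionAlgebra.imK_add, QuaternionAlgebra.re_smul,
      QuaternionAlgebra.imI_smul, QuaternionAlgebra.imJ_smul, QuaternionAlgebra.imK_smul,
      smul_eq_mul]
    fun_prop
  have hcz : ContinuousOn (fun p => Φ (zeta i2 i3 p)) Ω :=
    hc.comp hzc.continuousOn fun p hp => mem_image_of_mem _ hp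
  have sc : ∀ (c : HC → ℂ) (hcc : Continuous c)
      (hdq : ∀ (k : ℂ) (p q : HC), c (k • (p - q)) = k * (c p - c q))
      (m : (ℝ × ℝ × ℝ) →L[ℝ] ℂ) (s : ℂ →L[ℝ] (ℝ × ℝ × ℝ)) (hs : ∀ w, m (s w) = w)
      (ho : ∀ p q, c (op (zeta i2 i3 p) q) = m p * c q),
      ContinuousOn (fun p => c (Φ' (zeta i2 i3 p))) Ω ∧ ∃ W : ℝ × ℝ × ℝ → ℂ, ∀ p ∈ Ω, ∀ h,
      Tendsto (fun ε : ℝ => (ε : ℂ)⁻¹ * (c (Φ' (zeta i2 i3 (p + ε • h))) - c (Φ' (zeta i2 i3 p))))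
        (𝓝[>] 0) (𝓝 (m h * W p)) := by
    intro c hcc hdq m s hs ho
    refine scalar3 m s hs hΩ (U := fun p => c (Φ (zeta i2 i3 p))) (hcc.comp_continuousOn hcz) ?_
    intro p hp h
    have h1 := hd (zeta i2 i3 p) (mem_image_of_mem _ hp) (zeta i2 i3 h) ⟨h, rfl⟩
    have h2 := (hcc.tendsto _).comp h1
    rw [ho] at h2
    refine h2.congr fun ε => ?_
    simp only [Function.comp, hdq, zeta_add]
  obtain ⟨k1, W1, hW1⟩ := sc c1 cont_c1 c1_dq m1 s1 hs1 ho1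
  obtain ⟨k2, W2, hW2⟩ := sc c2 cont_c2 c2_dq m2 s2 hs2 ho2
  obtain ⟨k3, W3, hW3⟩ := sc c3 cont_c3 c3_dq m3 s3 hs3 ho3
  obtain ⟨k4, W4, hW4⟩ := sc c4 cont_c4 c4_dq m4 s4 hs4 ho4
  constructor
  · have hcomp : ContinuousOn (fun p => Φ' (zeta i2 i3 p)) Ω := fun p hp =>
      tendsto_HC (k1 p hp) (k2 p hp) (k3 p hp) (k4 p hp)
    have h1 : ContinuousOn (fun q => Φ' (zeta i2 i3 (inv q))) (zeta i2 i3 '' Ω) := by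
      refine ContinuousOn.comp (f := inv) hcomp hinvc.continuousOn ?_
      rintro _ ⟨p, hp, rfl⟩
      rwa [hinv]
    refine h1.congr ?_
    rintro _ ⟨p, hp, rfl⟩
    simp only [hinv]
  · refine ⟨fun q => mkHC (W1 (inv q), W2 (inv q), W3 (inv q), W4 (inv q)), ?_⟩
    rintro _ ⟨p, hp, rfl⟩ _ ⟨h, rfl⟩
    obtain ⟨d1, d2, d3, d4⟩ := c_mkHC (W1 p, W2 p, W3 p, W4 p)
    simp only [hinv, zeta_add]
    refine tendsto_HC ?_ ?_ ?_ ?_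
    · rw [ho1, d1]; simp only [c1_dq]; exact hW1 p hp h
    · rw [ho2, d2]; simp only [c2_dq]; exact hW2 p hp h
    · rw [ho3, d3]; simp only [c3_dq]; exact hW3 p hp h
    · rw [ho4, d4]; simp only [c4_dq]; exact hW4 p hp h

lemma gen_seq {X : Type*} (C : X → Prop) (D : X → X → Prop)
    (hstep : ∀ Φ Φ', C Φ → D Φ Φ' → C Φ' ∧ ∃ Φ'', D Φ' Φ'') (Φ : X) (h0 : C Φ)
    (h1 : ∃ Φ', D Φ Φ') :
    ∃ Φs : ℕ → X, Φs 0 = Φ ∧ ∀ n, D (Φs n) (Φs (n + 1)) ∧ C (Φs n) := by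
  have hn : ∀ x : {Ψ : X // C Ψ ∧ ∃ Ψ', D Ψ Ψ'}, ∃ y : {Ψ : X // C Ψ ∧ ∃ Ψ', D Ψ Ψ'},
      D x.1 y.1 := by
    rintro ⟨Ψ, hΨ, Ψ', hd⟩
    exact ⟨⟨Ψ', hstep Ψ Ψ' hΨ hd⟩, hd⟩
  choose nxt hnxt using hn
  let sq : ℕ → {Ψ : X // C Ψ ∧ ∃ Ψ', D Ψ Ψ'} := fun n => Nat.rec ⟨Φ, h0, h1⟩ (fun _ x => nxt x) n
  exact ⟨fun n => (sq n).1, rfl, fun n => ⟨hnxt (sq n), (sq n).2.1⟩⟩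

lemma exists_inv (a₁ a₂ b₁ b₂ : ℂ)
    (hLI : LinIndep (a₁ • e1 + a₂ • e2) (b₁ • e1 + b₂ • e2)) :
    ∃ inv : HC → ℝ × ℝ × ℝ, Continuous inv ∧
      ∀ p, inv (zeta (a₁ • e1 + a₂ • e2) (b₁ • e1 + b₂ • e2) p) = p := by
  let T : (ℝ × ℝ × ℝ) →ₗ[ℝ] ℂ × ℂ := ((xiL a₁ b₁).prod (xiL a₂ b₂)).toLinearMap
  have hT : LinearMap.ker T = ⊥ := by
    rw [LinearMap.ker_eq_bot']
    intro p hp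
    have h1 : xi a₁ b₁ p = 0 := congrArg Prod.fst hp
    have h2 : xi a₂ b₂ p = 0 := congrArg Prod.snd hp
    have h3 := zeta_eq a₁ a₂ b₁ b₂ p
    rw [h1, h2] at h3
    have h4 : mkHC (0, 0, 0, 0) = 0 := by ext <;> simp [mkHC]
    rw [h4] at h3
    obtain ⟨k1, k2, k3⟩ := hLI p.1 p.2.1 p.2.2 h3
    exact Prod.ext k1 (Prod.ext k2 k3)
  obtain ⟨g, hg⟩ := T.exists_leftInverse_of_injective hT
  refine ⟨fun q => g (c1 q, c2 q), ?_, ?_⟩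
  · exact g.continuous_of_finiteDimensional.comp (cont_c1.prodMk cont_c2)
  · intro p
    simp only [zeta_eq, (c_mkHC _).1, (c_mkHC _).2.1]
    exact LinearMap.congr_fun hg p

/-- Theorem 8: the Gateaux derivatives of all orders of a right-G-monogenic
(resp. left-G-monogenic) map on a domain convex in the directions of `L₁`, `L₂` are again
right-G-monogenic (resp. left-G-monogenic). -/
theorem statement16 (a₁ a₂ b₁ b₂ : ℂ) (i2 i3 : HC)
    (hi2 : i2 = a₁ • e1 + a₂ • e2) (hi3 : i3 = b₁ • e1 + b₂ • e2)
    (hLI : LinIndep i2 i3)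
    (Ω : Set (ℝ × ℝ × ℝ)) (hΩo : IsOpen Ω) (hΩc : IsConnected Ω)
    (hconv1 : ConvexInDirection Ω (lineL a₁ b₁)) (hconv2 : ConvexInDirection Ω (lineL a₂ b₂))
    (hab1 : a₁ ∉ Set.range ((↑) : ℝ → ℂ) ∨ b₁ ∉ Set.range ((↑) : ℝ → ℂ))
    (hab2 : a₂ ∉ Set.range ((↑) : ℝ → ℂ) ∨ b₂ ∉ Set.range ((↑) : ℝ → ℂ))
    (Φ Φh : HC → HC)
    (hΦ : RightGMonogenic i2 i3 Φ (zeta i2 i3 '' Ω))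
    (hΦh : LeftGMonogenic i2 i3 Φh (zeta i2 i3 '' Ω)) :
    (∃ Φs : ℕ → HC → HC, Φs 0 = Φ ∧
      ∀ n : ℕ, IsRightGDeriv i2 i3 (Φs n) (Φs (n + 1)) (zeta i2 i3 '' Ω) ∧
        RightGMonogenic i2 i3 (Φs n) (zeta i2 i3 '' Ω)) ∧
    (∃ Φhs : ℕ → HC → HC, Φhs 0 = Φh ∧
      ∀ n : ℕ, IsLeftGDeriv i2 i3 (Φhs n) (Φhs (n + 1)) (zeta i2 i3 '' Ω) ∧
        LeftGMonogenic i2 i3 (Φhs n) (zeta i2 i3 '' Ω)) := by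
  subst hi2 hi3
  obtain ⟨inv, hic, hinv⟩ := exists_inv a₁ a₂ b₁ b₂ hLI
  obtain ⟨s, hs⟩ := xiL_section hab1
  obtain ⟨t, ht⟩ := xiL_section hab2
  constructor
  · obtain ⟨hc, hex⟩ := hΦ
    choose! Φ' hΦ' using hex
    obtain ⟨Φs, h0, hn⟩ := gen_seq
      (fun Ψ : HC → HC => ContinuousOn Ψ (zeta (a₁ • e1 + a₂ • e2) (b₁ • e1 + b₂ • e2) '' Ω))
      (fun Ψ Ψ' => IsRightGDeriv (a₁ • e1 + a₂ • e2) (b₁ • e1 + b₂ • e2) Ψ Ψ'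
        (zeta (a₁ • e1 + a₂ • e2) (b₁ • e1 + b₂ • e2) '' Ω))
      (fun Ψ Ψ' hC hD => gen_step _ _ (fun h q => h * q) inv hic hinv
        (xiL a₁ b₁) (xiL a₂ b₂) (xiL a₁ b₁) (xiL a₂ b₂) s t s t hs ht hs ht
        (fun p q => by rw [zeta_eq]; exact (mul_right_c _ _ q).1)
        (fun p q => by rw [zeta_eq]; exact (mul_right_c _ _ q).2.1)
        (fun p q => by rw [zeta_eq]; exact (mul_right_c _ _ q).2.2.1)
        (fun p q => by rw [zeta_eq]; exact (mul_right_c _ _ q).2.2.2)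
        Ω hΩo Ψ Ψ' hC hD)
      Φ hc ⟨Φ', hΦ'⟩
    exact ⟨Φs, h0, fun n => ⟨(hn n).1, (hn n).2, fun ζ hζ => ⟨_, (hn n).1 ζ hζ⟩⟩⟩
  · obtain ⟨hc, hex⟩ := hΦh
    choose! Φ' hΦ' using hex
    obtain ⟨Φs, h0, hn⟩ := gen_seq
      (fun Ψ : HC → HC => ContinuousOn Ψ (zeta (a₁ • e1 + a₂ • e2) (b₁ • e1 + b₂ • e2) '' Ω))
      (fun Ψ Ψ' => IsLeftGDeriv (a₁ • e1 + a₂ • e2) (b₁ • e1 + b₂ • e2) Ψ Ψ'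
        (zeta (a₁ • e1 + a₂ • e2) (b₁ • e1 + b₂ • e2) '' Ω))
      (fun Ψ Ψ' hC hD => gen_step _ _ (fun h q => q * h) inv hic hinv
        (xiL a₁ b₁) (xiL a₂ b₂) (xiL a₂ b₂) (xiL a₁ b₁) s t t s hs ht ht hs
        (fun p q => by rw [zeta_eq]; exact (mul_left_c _ _ q).1)
        (fun p q => by rw [zeta_eq]; exact (mul_left_c _ _ q).2.1)
        (fun p q => by rw [zeta_eq]; exact (mul_left_c _ _ q).2.2.1)
        (fun p q => by rw [zeta_eq]; exact (mul_left_c _ _ q).2.2.2)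
        Ω hΩo Ψ Ψ' hC hD)
      Φh hc ⟨Φ', hΦ'⟩
    exact ⟨Φs, h0, fun n => ⟨(hn n).1, (hn n).2, fun ζ hζ => ⟨_, (hn n).1 ζ hζ⟩⟩⟩

end
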